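/- Let λ < 0 and δ > 0, and let g : (0,δ) → ℝ be measurable with ∫₀^δ t^{-2λ} g(t)² dt/t < ∞. Then there exists a unique locally absolutely continuous function u on (0,δ) such that: v·u'(v) = g(v) for almost every v, ∫₀^δ v^{-2λ} u(v)² dv/v < ∞, and ∫₀^δ v^{-2λ} u(v) dv/v = 0 (orthogonality to constants). Moreover u = (Id − P_{λ,δ})(ũ), where ũ(v) = −∫_v^δ g(t)/t dt and P_{λ,δ}(f) = (−2λ/δ^{−2λ}) ∫₀^δ t^{−2λ} f(t) dt/t. -/

import Mathlib

open MeasureTheory Set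

theorem setIntegral_Ioo_rpow_sub_one {p δ : ℝ} (hp : 0 < p) (hδ : 0 < δ) :
    ∫ v in Ioo 0 δ, v ^ (p - 1) = δ ^ p / p := by
  rw [← integral_Ioc_eq_integral_Ioo, ← intervalIntegral.integral_of_le hδ.le,
    integral_rpow (Or.inl (by linarith))]
  simp [Real.zero_rpow hp.ne']

theorem setLIntegral_Ioo_rpow_sub_one {p δ : ℝ} (hp : 0 < p) (hδ : 0 < δ) :
    ∫⁻ v in Ioo 0 δ, ENNReal.ofReal (v ^ (p - 1)) = ENNReal.ofReal (δ ^ p / p) := by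
  rw [← setIntegral_Ioo_rpow_sub_one hp hδ, ofReal_integral_eq_lintegral_ofReal]
  · exact (intervalIntegral.integrableOn_Ioo_rpow_iff hδ).2 (by linarith)
  · filter_upwards [ae_restrict_mem measurableSet_Ioo] with v hv
    exact Real.rpow_nonneg hv.1.le _

theorem setLIntegral_Ioo_rpow_neg_sub_one_le {q v δ : ℝ} (hq : 0 < q) (hv : 0 < v) :
    ∫⁻ t in Ioo v δ, ENNReal.ofReal (t ^ (-q - 1)) ≤ ENNReal.ofReal (v ^ (-q) / q) := by
  refine (lintegral_mono_set Ioo_subset_Ioi_self).trans_eq ?_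
  rw [← ofReal_integral_eq_lintegral_ofReal
    (integrableOn_Ioi_rpow_of_lt (by linarith) hv), integral_Ioi_rpow_of_lt (by linarith) hv]
  · congr 1
    rw [sub_add_cancel, neg_div_neg_eq]
  · filter_upwards [ae_restrict_mem measurableSet_Ioi] with t ht
    exact Real.rpow_nonneg (hv.trans ht).le _

theorem sq_lintegral_mul_le {α : Type*} [MeasurableSpace α] {μ : Measure α} {f g : α → ENNReal}
    (hf : AEMeasurable f μ) (hg : AEMeasurable g μ) :
    (∫⁻ a, f a * g a ∂μ) ^ 2 ≤ (∫⁻ a, f a ^ 2 ∂μ) * ∫⁻ a, g a ^ 2 ∂μ := by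
  have h := ENNReal.lintegral_mul_le_Lp_mul_Lq μ Real.HolderConjugate.two_two hf hg
  have hsq : ∀ x : ENNReal, (x ^ (1 / 2 : ℝ)) ^ 2 = x := fun x => by
    rw [← ENNReal.rpow_natCast, ← ENNReal.rpow_mul]
    norm_num
  calc (∫⁻ a, f a * g a ∂μ) ^ 2
      ≤ ((∫⁻ a, f a ^ (2 : ℝ) ∂μ) ^ (1 / 2 : ℝ) * (∫⁻ a, g a ^ (2 : ℝ) ∂μ) ^ (1 / 2 : ℝ)) ^ 2 :=
        pow_le_pow_left' h 2
    _ = _ := by simp only [mul_pow, hsq, ENNReal.rpow_two]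

/-- Pointwise Cauchy–Schwarz bound for the primitive of `g t / t` vanishing at `δ`. -/
theorem enorm_sq_setIntegral_div_le {q v δ : ℝ} (hq : 0 < q) (hv : 0 < v) {g : ℝ → ℝ}
    (hg : Measurable g) :
    ‖∫ t in Ioo v δ, g t / t‖ₑ ^ 2 ≤
      (∫⁻ t in Ioo v δ, ENNReal.ofReal (t ^ (q - 1) * g t ^ 2)) *
        ENNReal.ofReal (v ^ (-q) / q) := by
  have hsplit : ∫⁻ t in Ioo v δ, ‖g t / t‖ₑ =
      ∫⁻ t in Ioo v δ, ENNReal.ofReal (t ^ ((q - 1) / 2) * |g t|) *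
        ENNReal.ofReal (t ^ ((-q - 1) / 2)) := by
    refine setLIntegral_congr_fun measurableSet_Ioo fun t ht => ?_
    have ht0 : 0 < t := hv.trans ht.1
    have h1 : t ^ ((q - 1) / 2) * t ^ ((-q - 1) / 2) = t⁻¹ := by
      rw [← Real.rpow_add ht0, ← Real.rpow_neg_one]
      congr 1
      ring
    rw [← ENNReal.ofReal_mul (by positivity), Real.enorm_eq_ofReal_abs, abs_div, abs_of_pos ht0,
      div_eq_mul_inv, ← h1]
    congr 1
    ring
  have hf2 : ∫⁻ t in Ioo v δ, ENNReal.ofReal (t ^ ((q - 1) / 2) * |g t|) ^ 2 =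
      ∫⁻ t in Ioo v δ, ENNReal.ofReal (t ^ (q - 1) * g t ^ 2) := by
    refine setLIntegral_congr_fun measurableSet_Ioo fun t ht => ?_
    have ht0 : 0 < t := hv.trans ht.1
    rw [← ENNReal.ofReal_pow (by positivity), mul_pow, sq_abs, ← Real.rpow_mul_natCast ht0.le]
    norm_num
  have hk2 : ∫⁻ t in Ioo v δ, ENNReal.ofReal (t ^ ((-q - 1) / 2)) ^ 2 =
      ∫⁻ t in Ioo v δ, ENNReal.ofReal (t ^ (-q - 1)) := by
    refine setLIntegral_congr_fun measurableSet_Ioo fun t ht => ?_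
    have ht0 : 0 < t := hv.trans ht.1
    rw [← ENNReal.ofReal_pow (by positivity), ← Real.rpow_mul_natCast ht0.le]
    norm_num
  calc ‖∫ t in Ioo v δ, g t / t‖ₑ ^ 2
      ≤ (∫⁻ t in Ioo v δ, ‖g t / t‖ₑ) ^ 2 :=
        pow_le_pow_left' (enorm_integral_le_lintegral_enorm _) 2
    _ ≤ _ := by
        rw [hsplit]
        refine (sq_lintegral_mul_le (by fun_prop) (by fun_prop)).trans ?_
        rw [hf2, hk2]
        gcongr
        exact setLIntegral_Ioo_rpow_neg_sub_one_le hq hv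

/-- Hardy's inequality for the primitive of `g t / t` vanishing at `δ`. -/
theorem lintegral_hardy_Ioo {q δ : ℝ} (hq : 0 < q) {g : ℝ → ℝ} (hg : Measurable g) :
    ∫⁻ v in Ioo 0 δ, ENNReal.ofReal (v ^ (2 * q) * (∫ t in Ioo v δ, g t / t) ^ 2 / v) ≤
      ENNReal.ofReal (1 / q ^ 2) *
        ∫⁻ t in Ioo 0 δ, ENNReal.ofReal (t ^ (2 * q) * g t ^ 2 / t) := by
  set W : ℝ → ENNReal := fun t => ENNReal.ofReal (t ^ (q - 1) * g t ^ 2) with hW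
  set K : ℝ → ENNReal := fun v => ENNReal.ofReal (v ^ (q - 1)) with hK
  have hWm : Measurable W := by fun_prop
  have hKm : Measurable K := by fun_prop
  calc ∫⁻ v in Ioo 0 δ, ENNReal.ofReal (v ^ (2 * q) * (∫ t in Ioo v δ, g t / t) ^ 2 / v)
      ≤ ∫⁻ v in Ioo 0 δ, ∫⁻ t in Ioo 0 δ,
          ENNReal.ofReal (1 / q) * {x : ℝ × ℝ | x.1 < x.2}.indicator
            (fun x => K x.1 * W x.2) (v, t) := by
        refine setLIntegral_mono' measurableSet_Ioo fun v hv => ?_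
        have hv0 : 0 < v := hv.1
        have hpow : v ^ (2 * q) / v = v ^ (q - 1) * v ^ q := by
          rw [← Real.rpow_add hv0, ← Real.rpow_sub_one hv0.ne']
          congr 1
          ring
        have hneg : v ^ q * (v ^ (-q) / q) = 1 / q := by
          rw [Real.rpow_neg hv0.le]
          have := (Real.rpow_pos_of_pos hv0 q).ne'
          field_simp
        have hinner : ∫⁻ t in Ioo 0 δ, {x : ℝ × ℝ | x.1 < x.2}.indicator
            (fun x => K x.1 * W x.2) (v, t) = K v * ∫⁻ t in Ioo v δ, W t := by
          have : ∀ t, {x : ℝ × ℝ | x.1 < x.2}.indicator (fun x => K x.1 * W x.2) (v, t) =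
              (Ioi v).indicator (fun t => K v * W t) t := fun t => by
            simp [indicator]
          simp_rw [this]
          rw [setLIntegral_indicator measurableSet_Ioi, lintegral_const_mul _ hWm]
          congr 3
          ext t
          simp only [mem_inter_iff, mem_Ioi, mem_Ioo]
          exact ⟨fun h => ⟨h.1, h.2.2⟩, fun h => ⟨h.1, hv0.trans h.1, h.2⟩⟩
        rw [lintegral_const_mul' _ _ ENNReal.ofReal_ne_top, hinner]
        calc ENNReal.ofReal (v ^ (2 * q) * (∫ t in Ioo v δ, g t / t) ^ 2 / v)
            = K v * ENNReal.ofReal (v ^ q) * ‖∫ t in Ioo v δ, g t / t‖ₑ ^ 2 := by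
              rw [hK, Real.enorm_eq_ofReal_abs, ← ENNReal.ofReal_pow (abs_nonneg _), sq_abs,
                ← ENNReal.ofReal_mul (by positivity), ← ENNReal.ofReal_mul (by positivity),
                ← hpow]
              congr 1
              ring
          _ ≤ K v * ENNReal.ofReal (v ^ q) * ((∫⁻ t in Ioo v δ, W t) *
                ENNReal.ofReal (v ^ (-q) / q)) := by
              gcongr
              exact enorm_sq_setIntegral_div_le hq hv0 hg
          _ = ENNReal.ofReal (1 / q) * (K v * ∫⁻ t in Ioo v δ, W t) := by
              rw [← hneg, ENNReal.ofReal_mul (by positivity)]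
              ring
    _ = ∫⁻ t in Ioo 0 δ, ∫⁻ v in Ioo 0 δ,
          ENNReal.ofReal (1 / q) * {x : ℝ × ℝ | x.1 < x.2}.indicator
            (fun x => K x.1 * W x.2) (v, t) := by
        refine lintegral_lintegral_swap (Measurable.aemeasurable ?_)
        refine Measurable.const_mul (Measurable.indicator ?_ ?_) _
        · fun_prop
        · exact measurableSet_lt measurable_fst measurable_snd
    _ = ∫⁻ t in Ioo 0 δ, ENNReal.ofReal (1 / q ^ 2) *
          ENNReal.ofReal (t ^ (2 * q) * g t ^ 2 / t) := by
        refine setLIntegral_congr_fun measurableSet_Ioo fun t ht => ?_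
        have ht0 : 0 < t := ht.1
        have : ∀ v, {x : ℝ × ℝ | x.1 < x.2}.indicator (fun x => K x.1 * W x.2) (v, t) =
            (Iio t).indicator (fun v => K v * W t) v := fun v => by
          simp [indicator]
        have hset : Iio t ∩ Ioo 0 δ = Ioo 0 t := by
          ext v
          simp only [mem_inter_iff, mem_Iio, mem_Ioo]
          exact ⟨fun h => ⟨h.2.1, h.1⟩, fun h => ⟨h.2, h.1, h.2.trans ht.2⟩⟩
        simp_rw [this]
        rw [lintegral_const_mul' _ _ ENNReal.ofReal_ne_top,
          setLIntegral_indicator measurableSet_Iio, hset, lintegral_mul_const _ hKm,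
          setLIntegral_Ioo_rpow_sub_one hq ht0, hW, ← ENNReal.ofReal_mul (by positivity),
          ← ENNReal.ofReal_mul (by positivity), ← ENNReal.ofReal_mul (by positivity)]
        congr 1
        rw [two_mul, Real.rpow_add ht0, Real.rpow_sub_one ht0.ne']
        field_simp
    _ = _ := lintegral_const_mul' _ _ ENNReal.ofReal_ne_top

/-- Membership in the weighted space forces integrability of `g t / t` away from `0`. -/
theorem integrableOn_Ioo_div_of_lintegral_lt_top {p a δ : ℝ} (ha : 0 < a) {g : ℝ → ℝ}
    (hmeas : Measurable g)
    (hg : ∫⁻ t in Ioo 0 δ, ENNReal.ofReal (t ^ p * g t ^ 2 / t) < ⊤) :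
    IntegrableOn (fun t => g t / t) (Ioo a δ) := by
  have h1 : IntegrableOn (fun t => t ^ p * g t ^ 2 / t) (Ioo 0 δ) := by
    refine (lintegral_ofReal_ne_top_iff_integrable
      (Measurable.aestronglyMeasurable (by fun_prop)) ?_).1 hg.ne
    filter_upwards [ae_restrict_mem measurableSet_Ioo] with t ht
    have := ht.1
    simp only [Pi.zero_apply]
    positivity
  have h2 : IntegrableOn (fun t : ℝ => t ^ (-p - 1)) (Ioo a δ) := by
    refine (ContinuousOn.integrableOn_Icc fun t ht => ?_).mono_set Ioo_subset_Icc_self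
    exact (Real.continuousAt_rpow_const _ _ (Or.inl (ha.trans_le ht.1).ne')).continuousWithinAt
  refine ((h1.mono_set (Ioo_subset_Ioo_left ha.le)).add h2).mono'
    (Measurable.aestronglyMeasurable (by fun_prop)) ?_
  filter_upwards [ae_restrict_mem measurableSet_Ioo] with t ht
  have ht0 : 0 < t := ha.trans ht.1
  have hx : 0 < t ^ p := Real.rpow_pos_of_pos ht0 p
  simp only [Pi.add_apply]
  rw [Real.rpow_sub_one ht0.ne', Real.rpow_neg ht0.le, ← add_div, Real.norm_eq_abs, abs_div,
    abs_of_pos ht0]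
  gcongr
  have hi : 0 < (t ^ p)⁻¹ := inv_pos.2 hx
  have hxi : t ^ p * (t ^ p)⁻¹ = 1 := mul_inv_cancel₀ hx.ne'
  generalize t ^ p = x at *
  generalize x⁻¹ = y at *
  rw [← sq_abs]
  have : 0 ≤ y * (x * |g t| - 1) ^ 2 := by positivity
  have e : y * (x * |g t| - 1) ^ 2 = x * |g t| ^ 2 - 2 * |g t| + y := by
    linear_combination (x * |g t| ^ 2 - 2 * |g t|) * hxi
  have := abs_nonneg (g t)
  linarith

theorem stronglyMeasurable_setIntegral_Ioo {h : ℝ → ℝ} (hh : Measurable h) (δ : ℝ) :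
    StronglyMeasurable fun v => ∫ t in Ioo v δ, h t := by
  have : (fun v => ∫ t in Ioo v δ, h t) =
      fun v => ∫ t, {x : ℝ × ℝ | x.1 < x.2 ∧ x.2 < δ}.indicator (fun x => h x.2) (v, t) := by
    ext v
    rw [← integral_indicator measurableSet_Ioo]
    simp [indicator]
  rw [this]
  refine StronglyMeasurable.integral_prod_right' (Measurable.stronglyMeasurable ?_)
  refine Measurable.indicator (by fun_prop) ?_
  exact (measurableSet_lt measurable_fst measurable_snd).inter
    (measurableSet_lt measurable_snd measurable_const)

/-- A function in the weighted `L²` space is integrable against the weight, if the weight is. -/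
theorem integrableOn_rpow_mul_div {p δ : ℝ} (hp : 0 < p) (hδ : 0 < δ) {f : ℝ → ℝ}
    (hf : Measurable f)
    (hfin : ∫⁻ t in Ioo 0 δ, ENNReal.ofReal (t ^ p * f t ^ 2 / t) < ⊤) :
    IntegrableOn (fun t => t ^ p * f t / t) (Ioo 0 δ) := by
  have h1 : IntegrableOn (fun t => t ^ p * f t ^ 2 / t) (Ioo 0 δ) := by
    refine (lintegral_ofReal_ne_top_iff_integrable
      (Measurable.aestronglyMeasurable (by fun_prop)) ?_).1 hfin.ne
    filter_upwards [ae_restrict_mem measurableSet_Ioo] with t ht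
    have := ht.1
    simp only [Pi.zero_apply]
    positivity
  have h2 : IntegrableOn (fun t : ℝ => t ^ (p - 1)) (Ioo 0 δ) :=
    (intervalIntegral.integrableOn_Ioo_rpow_iff hδ).2 (by linarith)
  refine (h1.add h2).mono' (Measurable.aestronglyMeasurable (by fun_prop)) ?_
  filter_upwards [ae_restrict_mem measurableSet_Ioo] with t ht
  have ht0 : 0 < t := ht.1
  have hx : 0 < t ^ p := Real.rpow_pos_of_pos ht0 p
  simp only [Pi.add_apply]
  rw [Real.rpow_sub_one ht0.ne', ← add_div, Real.norm_eq_abs, abs_div, abs_mul,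
    abs_of_pos ht0, abs_of_pos hx, ← mul_add_one, ← sq_abs (f t)]
  gcongr
  nlinarith [sq_nonneg (|f t| - 1), sq_nonneg (|f t|)]

/-- For `λ < 0`, there is a unique locally absolutely continuous `u` on `(0,δ)` with
`v·u'(v) = g(v)` a.e. (encoded by `u` being an indefinite integral of `g t / t` on compact
subintervals), lying in `v^λ L²_b((0,δ))` and orthogonal to the constants; moreover
`u = (Id − P_{λ,δ})(ũ)` where `ũ(v) = −∫_v^δ g(t) dt/t` and
`P_{λ,δ}(f) = (−2λ/δ^{−2λ}) ∫₀^δ t^{−2λ} f(t) dt/t`. -/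
theorem weighted_b_primitive_neg_weight_unique_orthogonal
    (lam δ : ℝ) (hlam : lam < 0) (hδ : 0 < δ) (g : ℝ → ℝ) (hmeas : Measurable g)
    (hg : ∫⁻ t in Ioo 0 δ, ENNReal.ofReal (t ^ (-(2 * lam)) * (g t) ^ 2 / t) < ⊤) :
    ∃ u : ℝ → ℝ,
      -- `u = (Id − P_{λ,δ})(ũ)` with `ũ(v) = −∫_v^δ g(t)/t dt`
      (∀ v : ℝ, u v =
        (-∫ t in Ioo v δ, g t / t) -
          (-(2 * lam) / δ ^ (-(2 * lam))) *
            ∫ t in Ioo 0 δ, t ^ (-(2 * lam)) * (-∫ s in Ioo t δ, g s / s) / t) ∧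
      -- `u` is locally absolutely continuous with `v·u'(v) = g(v)` a.e.
      (∀ a ∈ Ioo (0 : ℝ) δ, ∀ b ∈ Ioo (0 : ℝ) δ, u b - u a = ∫ t in a..b, g t / t) ∧
      (∀ᵐ v ∂(volume.restrict (Ioo 0 δ)), HasDerivAt u (g v / v) v) ∧
      -- `u` lies in the weighted space
      (∫⁻ v in Ioo 0 δ, ENNReal.ofReal (v ^ (-(2 * lam)) * (u v) ^ 2 / v) < ⊤) ∧
      -- `u` is orthogonal to the constants
      (∫ v in Ioo 0 δ, v ^ (-(2 * lam)) * u v / v) = 0 ∧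
      -- uniqueness among such functions
      (∀ w : ℝ → ℝ,
        (∀ a ∈ Ioo (0 : ℝ) δ, ∀ b ∈ Ioo (0 : ℝ) δ, w b - w a = ∫ t in a..b, g t / t) →
        (∫⁻ v in Ioo 0 δ, ENNReal.ofReal (v ^ (-(2 * lam)) * (w v) ^ 2 / v) < ⊤) →
        (∫ v in Ioo 0 δ, v ^ (-(2 * lam)) * w v / v) = 0 →
        ∀ v ∈ Ioo (0 : ℝ) δ, w v = u v) := by
  set p : ℝ := -(2 * lam) with hp_def
  have hp : 0 < p := by linarith
  set U : ℝ → ℝ := fun v => ∫ t in Ioo v δ, g t / t with hU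
  have hUm : Measurable U :=
    (stronglyMeasurable_setIntegral_Ioo (hmeas.div measurable_id) δ).measurable
  have hU2 : ∫⁻ v in Ioo 0 δ, ENNReal.ofReal (v ^ p * U v ^ 2 / v) < ⊤ := by
    have h := lintegral_hardy_Ioo (q := -lam) (δ := δ) (by linarith) hmeas
    rw [show 2 * -lam = p by rw [hp_def]; ring] at h
    exact h.trans_lt (ENNReal.mul_lt_top ENNReal.ofReal_lt_top hg)
  set c : ℝ := p / δ ^ p * ∫ t in Ioo 0 δ, t ^ p * (-U t) / t with hc
  have hδp : 0 < δ ^ p := Real.rpow_pos_of_pos hδ p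
  have hwt : ∀ v ∈ Ioo (0 : ℝ) δ, v ^ p / v = v ^ (p - 1) := fun v hv =>
    (Real.rpow_sub_one hv.1.ne' p).symm
  have hconst : ∀ k : ℝ, IntegrableOn (fun v => v ^ (p - 1) * k) (Ioo 0 δ) := fun k =>
    ((intervalIntegral.integrableOn_Ioo_rpow_iff hδ).2 (by linarith)).mul_const k
  have hadd : ∀ f : ℝ → ℝ, IntegrableOn (fun v => v ^ p * f v / v) (Ioo 0 δ) → ∀ k : ℝ,
      ∫ v in Ioo 0 δ, v ^ p * (f v + k) / v =
        (∫ v in Ioo 0 δ, v ^ p * f v / v) + δ ^ p / p * k := by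
    intro f hf k
    rw [← setIntegral_Ioo_rpow_sub_one hp hδ, ← integral_mul_const, ← integral_add hf (hconst k)]
    refine setIntegral_congr_fun measurableSet_Ioo fun v hv => ?_
    rw [← hwt v hv]
    ring
  have hnegU : IntegrableOn (fun v => v ^ p * (-U v) / v) (Ioo 0 δ) := by
    refine integrableOn_rpow_mul_div hp hδ hUm.neg ?_
    simpa only [neg_sq] using hU2
  have hint : ∀ a ∈ Ioo (0 : ℝ) δ, ∀ b ∈ Icc a δ,
      IntervalIntegrable (fun t => g t / t) volume a b := fun a ha b hb =>
    (intervalIntegrable_iff_integrableOn_Ioo_of_le hb.1).2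
      ((integrableOn_Ioo_div_of_lintegral_lt_top ha.1 hmeas hg).mono_set
        (Ioo_subset_Ioo_right hb.2))
  have hUi : ∀ a ∈ Ioo (0 : ℝ) δ, U a = ∫ t in a..δ, g t / t := fun a ha => by
    rw [intervalIntegral.integral_of_le ha.2.le, integral_Ioc_eq_integral_Ioo]
  have hprim : ∀ a ∈ Ioo (0 : ℝ) δ, ∀ b ∈ Ioo (0 : ℝ) δ,
      (-U b - c) - (-U a - c) = ∫ t in a..b, g t / t := by
    intro a ha b hb
    rw [hUi a ha, hUi b hb, ← intervalIntegral.integral_add_adjacent_intervals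
      ((hint a ha δ ⟨ha.2.le, le_rfl⟩).trans (hint b hb δ ⟨hb.2.le, le_rfl⟩).symm)
      (hint b hb δ ⟨hb.2.le, le_rfl⟩)]
    ring
  have hu0 : ∫ v in Ioo 0 δ, v ^ p * (-U v - c) / v = 0 := by
    simp only [sub_eq_add_neg (-U _) c]
    rw [hadd (fun v => -U v) hnegU (-c), hc]
    field_simp
    ring
  refine ⟨fun v => -U v - c, fun v => rfl, hprim, ?_, ?_, hu0, ?_⟩
  · rw [ae_restrict_iff' measurableSet_Ioo]
    have hall : ∀ᵐ x : ℝ, ∀ n : ℕ, x ∈ uIcc (δ / (n + 2)) δ → ∀ d ∈ uIcc (δ / (n + 2)) δ,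
        HasDerivAt (fun x => ∫ t in d..x, g t / t) (g x / x) x := by
      refine ae_all_iff.2 fun n => ?_
      have ha : δ / ((n : ℝ) + 2) ∈ Ioo 0 δ :=
        ⟨by positivity, div_lt_self hδ (by have := n.cast_nonneg (α := ℝ); linarith)⟩
      exact (hint _ ha δ ⟨ha.2.le, le_rfl⟩).ae_hasDerivAt_integral
    filter_upwards [hall] with x hx hx0
    obtain ⟨n, hn⟩ := exists_nat_gt (δ / x)
    have hle : δ / ((n : ℝ) + 2) ≤ x := by
      rw [div_lt_iff₀ hx0.1] at hn
      rw [div_le_iff₀ (by positivity)]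
      nlinarith [hx0.1]
    have hmem : x ∈ uIcc (δ / ((n : ℝ) + 2)) δ := by
      rw [uIcc_of_le (hle.trans hx0.2.le)]
      exact ⟨hle, hx0.2.le⟩
    refine ((hx n hmem x hmem).const_add (-U x - c)).congr_of_eventuallyEq ?_
    filter_upwards [Ioo_mem_nhds hx0.1 hx0.2] with y hy
    rw [← hprim x hx0 y hy]
    ring
  · have hk : ∫⁻ v in Ioo 0 δ, ENNReal.ofReal (v ^ (p - 1) * (2 * c ^ 2)) < ⊤ :=
      (hconst _).lintegral_lt_top
    refine lt_of_le_of_lt ?_ (ENNReal.add_lt_top.2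
      ⟨ENNReal.mul_lt_top (ENNReal.ofReal_lt_top (r := 2)) hU2, hk⟩)
    rw [← lintegral_const_mul' _ _ ENNReal.ofReal_ne_top, ← lintegral_add_right _ (by fun_prop)]
    refine setLIntegral_mono' measurableSet_Ioo fun v hv => ?_
    have hv0 : 0 < v := hv.1
    rw [← ENNReal.ofReal_mul zero_le_two, ← ENNReal.ofReal_add (by positivity) (by positivity),
      ← hwt v hv]
    refine ENNReal.ofReal_le_ofReal ?_
    have hw : 0 ≤ v ^ p / v := by positivity
    have := mul_nonneg hw (sq_nonneg (U v - c))
    calc v ^ p * (-U v - c) ^ 2 / v = v ^ p / v * (U v + c) ^ 2 := by ring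
      _ ≤ v ^ p / v * (U v + c) ^ 2 + v ^ p / v * (U v - c) ^ 2 := by linarith
      _ = _ := by ring
  · intro w hw _ hw0 v hv
    set k : ℝ := w v - (-U v - c) with hk
    have hwk : ∀ x ∈ Ioo (0 : ℝ) δ, w x = -U x + (k - c) := fun x hx => by
      have h1 := hw v hv x hx
      have h2 := hprim v hv x hx
      linarith
    have h0 : ∫ x in Ioo 0 δ, x ^ p * (-U x + (k - c)) / x = 0 := by
      refine (setIntegral_congr_fun measurableSet_Ioo fun x hx => ?_).trans hw0
      rw [hwk x hx]
    simp only [sub_eq_add_neg (-U _) c] at hu0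
    rw [hadd (fun v => -U v) hnegU] at h0 hu0
    have hz : δ ^ p / p * k = 0 := by linear_combination h0 - hu0
    have hk0 : k = 0 := (mul_eq_zero.1 hz).resolve_left (by positivity)
    linarith
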